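/- Let A and B be n×n matrices with nonnegative real entries whose tropical spectral radii μ = λ(A) and ν = λ(B) are positive, and let G be the associated function. If μ ≥ G(ν), then the Pareto frontier of the problem of minimizing (f(x), g(x)) over positive vectors x ∈ ℝⁿ consists of the single point (μ, ν), and the set of positive vectors x with f(x) = μ and g(x) = ν is exactly the set of vectors of the form x = (μ⁻¹A ⊕ ν⁻¹B)* ⊗ u with u ∈ ℝⁿ a positive vector. -/

import Mathlib

open scoped BigOperators

noncomputable section

/-- Tropical (max-times) matrix product. -/
def tmul {n : ℕ} (A B : Matrix (Fin n) (Fin n) ℝ) : Matrix (Fin n) (Fin n) ℝ :=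
  Matrix.of fun i j => ⨆ k, A i k * B k j

/-- Tropical matrix power: `A^0 = I`, `A^(k+1) = A ⊗ A^k`. -/
def tpow {n : ℕ} (A : Matrix (Fin n) (Fin n) ℝ) : ℕ → Matrix (Fin n) (Fin n) ℝ
  | 0 => Matrix.of fun i j => if i = j then (1 : ℝ) else 0
  | k + 1 => tmul A (tpow A k)

/-- Tropical trace: `tr A = max_i A i i`. -/
def ttr {n : ℕ} (A : Matrix (Fin n) (Fin n) ℝ) : ℝ := ⨆ i, A i i

/-- `Tr(A) = max_{1 ≤ k ≤ n} tr (A^k)`. -/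
def tTr {n : ℕ} (A : Matrix (Fin n) (Fin n) ℝ) : ℝ :=
  ⨆ k : Fin n, ttr (tpow A (k.1 + 1))

/-- Tropical spectral radius: `λ(A) = max_{1 ≤ k ≤ n} (tr (A^k))^(1/k)`. -/
def specRad {n : ℕ} (A : Matrix (Fin n) (Fin n) ℝ) : ℝ :=
  ⨆ k : Fin n, (ttr (tpow A (k.1 + 1))) ^ ((1 : ℝ) / ((k.1 : ℝ) + 1))

/-- Kleene star: `A* = I ⊕ A ⊕ ⋯ ⊕ A^(n-1)` (entrywise max of tropical powers). -/
def kstar {n : ℕ} (A : Matrix (Fin n) (Fin n) ℝ) : Matrix (Fin n) (Fin n) ℝ :=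
  Matrix.of fun i j => ⨆ k : Fin n, tpow A k.1 i j

/-- `B ⊗ A^(i₁) ⊗ B ⊗ A^(i₂) ⊗ ⋯ ⊗ B ⊗ A^(i_k)` for a list `(i₁, …, i_k)`. -/
def wordProd {n : ℕ} (A B : Matrix (Fin n) (Fin n) ℝ) : List ℕ → Matrix (Fin n) (Fin n) ℝ
  | [] => tpow A 0
  | i :: l => tmul (tmul B (tpow A i)) (wordProd A B l)

/-- The function `G(s)` associated with matrices `A`, `B`. -/
def Gfun {n : ℕ} (A B : Matrix (Fin n) (Fin n) ℝ) (s : ℝ) : ℝ :=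
  sSup { v : ℝ | ∃ (k m : ℕ) (t : Fin k → ℕ),
    1 ≤ k ∧ k ≤ n - 1 ∧ 1 ≤ m ∧ m ≤ n - k ∧ (∑ j, t j) = m ∧
    v = s ^ (-(k : ℝ) / (m : ℝ)) *
      (ttr (wordProd A B (List.ofFn t))) ^ ((1 : ℝ) / (m : ℝ)) }

/-- The function `H(t)` associated with matrices `A`, `B`. -/
def Hfun {n : ℕ} (A B : Matrix (Fin n) (Fin n) ℝ) (t : ℝ) : ℝ :=
  sSup { v : ℝ | ∃ (k m : ℕ) (w : Fin k → ℕ),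
    1 ≤ k ∧ k ≤ n - 1 ∧ 1 ≤ m ∧ m ≤ n - k ∧ (∑ j, w j) = m ∧
    v = t ^ (-(m : ℝ) / (k : ℝ)) *
      (ttr (wordProd A B (List.ofFn w))) ^ ((1 : ℝ) / (k : ℝ)) }

/-- The objective `f(x) = max_{i,j} A i j * x j / x i`. -/
def obj {n : ℕ} (A : Matrix (Fin n) (Fin n) ℝ) (x : Fin n → ℝ) : ℝ :=
  ⨆ i, ⨆ j, A i j * x j / x i

/-- `x` is a positive Pareto-optimal point for minimizing `(obj A, obj B)`. -/
def ParetoOptimal {n : ℕ} (A B : Matrix (Fin n) (Fin n) ℝ) (x : Fin n → ℝ) : Prop :=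
  (∀ i, 0 < x i) ∧
    ¬ ∃ y : Fin n → ℝ, (∀ i, 0 < y i) ∧ obj A y ≤ obj A x ∧ obj B y ≤ obj B x ∧
      (obj A y, obj B y) ≠ (obj A x, obj B x)

/-- The Pareto frontier of the bi-objective problem. -/
def ParetoFrontier {n : ℕ} (A B : Matrix (Fin n) (Fin n) ℝ) : Set (ℝ × ℝ) :=
  { p | ∃ x : Fin n → ℝ, ParetoOptimal A B x ∧ p = (obj A x, obj B x) }

theorem le_tmul {n : ℕ} (A B : Matrix (Fin n) (Fin n) ℝ) (i k j : Fin n) :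
    A i k * B k j ≤ tmul A B i j :=
  le_ciSup (f := fun k => A i k * B k j) (Set.finite_range _).bddAbove k

theorem ex_tmul {n : ℕ} [Nonempty (Fin n)] (A B : Matrix (Fin n) (Fin n) ℝ) (i j : Fin n) :
    ∃ k, tmul A B i j = A i k * B k j := by
  obtain ⟨k, hk⟩ := exists_eq_ciSup_of_finite (f := fun k => A i k * B k j)
  exact ⟨k, hk.symm⟩

theorem tmul_nonneg {n : ℕ} {A B : Matrix (Fin n) (Fin n) ℝ}
    (hA : ∀ i j, 0 ≤ A i j) (hB : ∀ i j, 0 ≤ B i j) (i j : Fin n) : 0 ≤ tmul A B i j :=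
  Real.iSup_nonneg fun k => mul_nonneg (hA i k) (hB k j)

theorem tpow_nonneg {n : ℕ} {A : Matrix (Fin n) (Fin n) ℝ}
    (hA : ∀ i j, 0 ≤ A i j) (k : ℕ) (i j : Fin n) : 0 ≤ tpow A k i j := by
  induction k generalizing i j with
  | zero => simp only [tpow, Matrix.of_apply]; split_ifs <;> norm_num
  | succ k ih => exact tmul_nonneg hA ih i j

theorem tmul_assoc' {n : ℕ} [Nonempty (Fin n)] {A B C : Matrix (Fin n) (Fin n) ℝ}
    (hA : ∀ i j, 0 ≤ A i j) (hC : ∀ i j, 0 ≤ C i j) :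
    tmul (tmul A B) C = tmul A (tmul B C) := by
  ext i j
  apply le_antisymm
  · obtain ⟨k, hk⟩ := ex_tmul (tmul A B) C i j
    obtain ⟨l, hl⟩ := ex_tmul A B i k
    rw [hk, hl, mul_assoc]
    exact (mul_le_mul_of_nonneg_left (le_tmul B C l k j) (hA i l)).trans (le_tmul A _ i l j)
  · obtain ⟨k, hk⟩ := ex_tmul A (tmul B C) i j
    obtain ⟨l, hl⟩ := ex_tmul B C k j
    rw [hk, hl, ← mul_assoc]
    exact (mul_le_mul_of_nonneg_right (le_tmul A B i k l) (hC l j)).trans (le_tmul _ C i l j)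

theorem one_tmul' {n : ℕ} [Nonempty (Fin n)] {A B : Matrix (Fin n) (Fin n) ℝ}
    (hB : ∀ i j, 0 ≤ B i j) : tmul (tpow A 0) B = B := by
  ext i j
  apply le_antisymm
  · obtain ⟨k, hk⟩ := ex_tmul (tpow A 0) B i j
    rw [hk]
    simp only [tpow, Matrix.of_apply]
    split_ifs with h
    · simp [h]
    · simpa using hB i j
  · have := le_tmul (tpow A 0) B i i j
    simpa [tpow] using this

theorem tpow_mul_le {n : ℕ} [Nonempty (Fin n)] {A : Matrix (Fin n) (Fin n) ℝ}
    (hA : ∀ i j, 0 ≤ A i j) (a b : ℕ) (i k j : Fin n) :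
    tpow A a i k * tpow A b k j ≤ tpow A (a + b) i j := by
  have : tpow A (a + b) = tmul (tpow A a) (tpow A b) := by
    induction a with
    | zero => rw [one_tmul' (tpow_nonneg hA b), Nat.zero_add]
    | succ a ih =>
      rw [Nat.succ_add]
      simp only [tpow]
      rw [ih, tmul_assoc' hA (tpow_nonneg hA b)]
  rw [this]
  exact le_tmul _ _ i k j

theorem le_ttr {n : ℕ} (A : Matrix (Fin n) (Fin n) ℝ) (i : Fin n) : A i i ≤ ttr A :=
  le_ciSup (f := fun i => A i i) (Set.finite_range _).bddAbove i

theorem ttr_nonneg {n : ℕ} {A : Matrix (Fin n) (Fin n) ℝ} (hA : ∀ i j, 0 ≤ A i j) :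
    0 ≤ ttr A := Real.iSup_nonneg fun i => hA i i

theorem obj_le_iff {n : ℕ} [Nonempty (Fin n)] (A : Matrix (Fin n) (Fin n) ℝ) {x : Fin n → ℝ}
    (hx : ∀ i, 0 < x i) (c : ℝ) : obj A x ≤ c ↔ ∀ i j, A i j * x j ≤ c * x i := by
  unfold obj
  rw [ciSup_le_iff (Set.finite_range _).bddAbove]
  refine forall_congr' fun i => ?_
  rw [ciSup_le_iff (Set.finite_range _).bddAbove]
  exact forall_congr' fun j => div_le_iff₀ (hx i)

theorem tpow_le_of {n : ℕ} [Nonempty (Fin n)] {A : Matrix (Fin n) (Fin n) ℝ}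
    (hA : ∀ i j, 0 ≤ A i j) {x : Fin n → ℝ} {c : ℝ} (hc : 0 ≤ c)
    (h : ∀ i j, A i j * x j ≤ c * x i) (hx : ∀ i, 0 < x i) (k : ℕ) (i j : Fin n) :
    tpow A k i j * x j ≤ c ^ k * x i := by
  induction k generalizing i with
  | zero =>
    simp only [tpow, Matrix.of_apply]
    split_ifs with h
    · simp [h]
    · simpa using (hx i).le
  | succ k ih =>
    obtain ⟨l, hl⟩ := ex_tmul A (tpow A k) i j
    calc tpow A (k+1) i j * x j = A i l * (tpow A k l j * x j) := by
          rw [← mul_assoc, ← hl]; rfl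
      _ ≤ A i l * (c ^ k * x l) := mul_le_mul_of_nonneg_left (ih l) (hA i l)
      _ = c ^ k * (A i l * x l) := by ring
      _ ≤ c ^ k * (c * x i) := mul_le_mul_of_nonneg_left (h i l) (pow_nonneg hc k)
      _ = c ^ (k+1) * x i := by ring

theorem specRad_le_obj {n : ℕ} [Nonempty (Fin n)] {A : Matrix (Fin n) (Fin n) ℝ}
    (hA : ∀ i j, 0 ≤ A i j) {x : Fin n → ℝ} (hx : ∀ i, 0 < x i) : specRad A ≤ obj A x := by
  have hc : 0 ≤ obj A x := Real.iSup_nonneg fun i => Real.iSup_nonneg fun j =>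
    div_nonneg (mul_nonneg (hA i j) (hx j).le) (hx i).le
  have h := (obj_le_iff A hx (obj A x)).1 le_rfl
  refine ciSup_le fun k => ?_
  have h1 : ttr (tpow A (k.1 + 1)) ≤ obj A x ^ (k.1 + 1) := ciSup_le fun i =>
    le_of_mul_le_mul_right (tpow_le_of hA hc h hx (k.1 + 1) i i) (hx i)
  have h2 := Real.rpow_le_rpow (ttr_nonneg (tpow_nonneg hA _)) h1
    (z := (1:ℝ) / ((k.1:ℝ) + 1)) (by positivity)
  refine h2.trans (le_of_eq ?_)
  rw [← Real.rpow_natCast, ← Real.rpow_mul hc]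
  push_cast
  rw [mul_one_div_cancel (by positivity), Real.rpow_one]

theorem tpow_diag_le {n : ℕ} [Nonempty (Fin n)] {A : Matrix (Fin n) (Fin n) ℝ}
    (hA : ∀ i j, 0 ≤ A i j) (p : ℕ) (h1 : 1 ≤ p) (h2 : p ≤ n) (i : Fin n) :
    tpow A p i i ≤ specRad A ^ p := by
  obtain ⟨q, rfl⟩ : ∃ q, p = q + 1 := ⟨p - 1, by omega⟩
  refine (le_ttr _ i).trans ?_
  have h0 := ttr_nonneg (tpow_nonneg hA (q+1))
  have h3 : (ttr (tpow A (q + 1))) ^ ((1 : ℝ) / ((q : ℝ) + 1)) ≤ specRad A :=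
    le_ciSup (f := fun k : Fin n => (ttr (tpow A (k.1 + 1))) ^ ((1 : ℝ) / ((k.1 : ℝ) + 1)))
      (Set.finite_range _).bddAbove (⟨q, by omega⟩ : Fin n)
  have h4 := pow_le_pow_left₀ (Real.rpow_nonneg h0 _) h3 (q+1)
  refine le_trans (le_of_eq ?_) h4
  rw [← Real.rpow_natCast, ← Real.rpow_mul h0]
  push_cast
  rw [one_div_mul_cancel (by positivity), Real.rpow_one]

/-- product of a word, `true` stands for `B`, `false` for `A`. -/
def wP {n : ℕ} (A B : Matrix (Fin n) (Fin n) ℝ) : List Bool → Matrix (Fin n) (Fin n) ℝ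
  | [] => tpow A 0
  | true :: l => tmul B (wP A B l)
  | false :: l => tmul A (wP A B l)

theorem wP_nonneg {n : ℕ} {A B : Matrix (Fin n) (Fin n) ℝ}
    (hA : ∀ i j, 0 ≤ A i j) (hB : ∀ i j, 0 ≤ B i j) (W : List Bool) :
    ∀ i j, 0 ≤ wP A B W i j := by
  induction W with
  | nil => exact tpow_nonneg hA 0
  | cons b W ih => cases b; exacts [tmul_nonneg hA ih, tmul_nonneg hB ih]

theorem wordProd_nonneg {n : ℕ} {A B : Matrix (Fin n) (Fin n) ℝ}
    (hA : ∀ i j, 0 ≤ A i j) (hB : ∀ i j, 0 ≤ B i j) (l : List ℕ) :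
    ∀ i j, 0 ≤ wordProd A B l i j := by
  induction l with
  | nil => exact tpow_nonneg hA 0
  | cons b W ih => exact tmul_nonneg (tmul_nonneg hB (tpow_nonneg hA b)) ih

theorem wP_append {n : ℕ} [Nonempty (Fin n)] {A B : Matrix (Fin n) (Fin n) ℝ}
    (hA : ∀ i j, 0 ≤ A i j) (hB : ∀ i j, 0 ≤ B i j) (W V : List Bool) :
    wP A B (W ++ V) = tmul (wP A B W) (wP A B V) := by
  induction W with
  | nil => exact (one_tmul' (wP_nonneg hA hB V)).symm
  | cons b W ih =>
    cases b
    · simp only [List.cons_append, wP]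
      rw [ih, tmul_assoc' hA (wP_nonneg hA hB V)]
    · simp only [List.cons_append, wP]
      rw [ih, tmul_assoc' hB (wP_nonneg hA hB V)]

theorem wP_form {n : ℕ} [Nonempty (Fin n)] {A B : Matrix (Fin n) (Fin n) ℝ}
    (hA : ∀ i j, 0 ≤ A i j) (hB : ∀ i j, 0 ≤ B i j) (W : List Bool) :
    ∃ (a : ℕ) (l : List ℕ), wP A B W = tmul (tpow A a) (wordProd A B l) ∧
      l.length = W.count true ∧ a + l.sum = W.count false := by
  induction W with
  | nil => exact ⟨0, [], by rw [one_tmul' (wordProd_nonneg hA hB _)]; rfl, by simp, by simp⟩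
  | cons b W ih =>
    obtain ⟨a, l, h1, h2, h3⟩ := ih
    cases b
    · refine ⟨a + 1, l, ?_, by simpa using h2, by simp; omega⟩
      simp only [wP, tpow]
      rw [h1, tmul_assoc' hA (wordProd_nonneg hA hB _)]
    · refine ⟨0, a :: l, ?_, by simpa using h2, by simp; omega⟩
      rw [one_tmul' (wordProd_nonneg hA hB _)]
      simp only [wP, wordProd]
      rw [h1, tmul_assoc' hB (wordProd_nonneg hA hB _)]

theorem wP_allA {n : ℕ} (A B : Matrix (Fin n) (Fin n) ℝ) (p : ℕ) :
    wP A B (List.replicate p false) = tpow A p := by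
  induction p with
  | zero => rfl
  | succ p ih => simp only [List.replicate_succ, wP, tpow, ih]

theorem wP_allB {n : ℕ} (A B : Matrix (Fin n) (Fin n) ℝ) (p : ℕ) :
    wP A B (List.replicate p true) = tpow B p := by
  induction p with
  | zero => rfl
  | succ p ih => simp only [List.replicate_succ, wP, tpow, ih]

theorem Gset_finite {n : ℕ} (A B : Matrix (Fin n) (Fin n) ℝ) (s : ℝ) :
    Set.Finite { v : ℝ | ∃ (k m : ℕ) (t : Fin k → ℕ),
    1 ≤ k ∧ k ≤ n - 1 ∧ 1 ≤ m ∧ m ≤ n - k ∧ (∑ j, t j) = m ∧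
    v = s ^ (-(k : ℝ) / (m : ℝ)) *
      (ttr (wordProd A B (List.ofFn t))) ^ ((1 : ℝ) / (m : ℝ)) } := by
  have : Set.Finite (⋃ k ∈ Set.Iic n, ⋃ m ∈ Set.Iic n,
      (fun t : Fin k → ℕ => s ^ (-(k : ℝ) / (m : ℝ)) *
      (ttr (wordProd A B (List.ofFn t))) ^ ((1 : ℝ) / (m : ℝ))) '' Set.Iic (fun _ => n)) :=
    (Set.finite_Iic n).biUnion fun k _ => (Set.finite_Iic n).biUnion fun m _ =>
      (Set.finite_Iic _).image _
  refine this.subset ?_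
  rintro v ⟨k, m, t, h1, h2, h3, h4, h5, rfl⟩
  simp only [Set.mem_iUnion]
  refine ⟨k, by simp; omega, m, by simp; omega, t, ?_, rfl⟩
  intro j
  have := Finset.single_le_sum (f := t) (fun _ _ => Nat.zero_le _) (Finset.mem_univ j)
  show t j ≤ n
  omega

theorem word_le {n : ℕ} [Nonempty (Fin n)] {A B : Matrix (Fin n) (Fin n) ℝ}
    (hA : ∀ i j, 0 ≤ A i j) (hB : ∀ i j, 0 ≤ B i j)
    (hν : 0 < specRad B) (h : Gfun A B (specRad B) ≤ specRad A) (l : List ℕ)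
    (h1 : 1 ≤ l.length) (h2 : 1 ≤ l.sum) (h3 : l.length + l.sum ≤ n) (i : Fin n) :
    wordProd A B l i i ≤ specRad A ^ l.sum * specRad B ^ l.length := by
  have h0 := ttr_nonneg (wordProd_nonneg hA hB l)
  refine (le_ttr _ i).trans ?_
  have h5 : specRad B ^ (-(l.length : ℝ) / (l.sum : ℝ)) *
      (ttr (wordProd A B l)) ^ ((1 : ℝ) / (l.sum : ℝ)) ≤ specRad A := by
    refine le_trans (le_csSup (Gset_finite A B (specRad B)).bddAbove ?_) h
    refine ⟨l.length, l.sum, l.get, h1, by omega, h2, by omega, ?_, ?_⟩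
    · rw [← List.sum_ofFn, List.ofFn_get]
    · rw [List.ofFn_get]
  have hm : (l.sum : ℝ) ≠ 0 := by positivity
  have h6 := pow_le_pow_left₀ (by positivity) h5 l.sum
  rw [mul_pow, ← Real.rpow_natCast, ← Real.rpow_natCast, ← Real.rpow_mul hν.le,
    ← Real.rpow_mul h0, div_mul_cancel₀ _ hm, div_mul_cancel₀ _ hm, Real.rpow_one,
    Real.rpow_neg hν.le, Real.rpow_natCast, inv_mul_le_iff₀ (by positivity)] at h6
  linarith

theorem wP_diag_le {n : ℕ} [Nonempty (Fin n)] {A B : Matrix (Fin n) (Fin n) ℝ}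
    (hA : ∀ i j, 0 ≤ A i j) (hB : ∀ i j, 0 ≤ B i j)
    (hν : 0 < specRad B) (h : Gfun A B (specRad B) ≤ specRad A) (W : List Bool)
    (h1 : 1 ≤ W.length) (h2 : W.length ≤ n) (i : Fin n) :
    wP A B W i i ≤ specRad A ^ W.count false * specRad B ^ W.count true := by
  by_cases ht : true ∈ W
  · by_cases hf : false ∈ W
    · obtain ⟨W1, W2, rfl⟩ := List.append_of_mem ht
      rw [wP_append hA hB]
      obtain ⟨k, hk⟩ := ex_tmul (wP A B W1) (wP A B (true :: W2)) i i
      have h3 : wP A B W1 i k * wP A B (true :: W2) k i ≤ wP A B (true :: (W2 ++ W1)) k k := by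
        rw [← List.cons_append, wP_append hA hB, mul_comm]
        exact le_tmul _ _ k i k
      rw [hk]
      refine h3.trans ?_
      obtain ⟨a, l, h4, h5, h6⟩ := wP_form hA hB (W2 ++ W1)
      have h7 : wP A B (true :: (W2 ++ W1)) = wordProd A B (a :: l) := by
        simp only [wP, wordProd]
        rw [h4, tmul_assoc' hB (wordProd_nonneg hA hB _)]
      rw [h7]
      have h8 := List.count_pos_iff.2 hf
      simp only [List.count_append, List.length_append, List.length_cons] at *
      have e1 : (a :: l).length = W1.count true + (true :: W2).count true := by simp; omega
      have e2 : (a :: l).sum = W1.count false + (true :: W2).count false := by simp; omega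
      have c1 := List.count_true_add_count_false W1
      have c2 := List.count_true_add_count_false (true :: W2)
      simp only [List.length_cons] at c2
      have := word_le hA hB hν h (a :: l) (by simp) (by omega) (by omega) k
      rwa [e1, e2] at this
    · have hW : W = List.replicate W.length true := List.eq_replicate_iff.2 ⟨rfl, fun b hb => by
        cases b
        · exact absurd hb hf
        · rfl⟩
      generalize W.length = p at *
      subst hW
      rw [wP_allB]
      simpa [List.count_replicate] using tpow_diag_le hB p h1 h2 i
  · have hW : W = List.replicate W.length false := List.eq_replicate_iff.2 ⟨rfl, fun b hb => by
      cases b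
      · rfl
      · exact absurd hb ht⟩
    generalize W.length = p at *
    subst hW
    rw [wP_allA]
    simpa [List.count_replicate] using tpow_diag_le hA p h1 h2 i

theorem tpow_le_wP {n : ℕ} [Nonempty (Fin n)] {A B C : Matrix (Fin n) (Fin n) ℝ}
    {μ ν : ℝ} (hμ : 0 < μ) (hν : 0 < ν) (hA : ∀ i j, 0 ≤ A i j) (hB : ∀ i j, 0 ≤ B i j)
    (hC : C = Matrix.of fun i' j' => max (A i' j' / μ) (B i' j' / ν)) (p : ℕ) (i j : Fin n) :
    ∃ W : List Bool, W.length = p ∧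
      tpow C p i j * (μ ^ W.count false * ν ^ W.count true) ≤ wP A B W i j := by
  induction p generalizing i with
  | zero => exact ⟨[], rfl, by simp [wP, tpow]⟩
  | succ p ih =>
    obtain ⟨k, hk⟩ := ex_tmul C (tpow C p) i j
    obtain ⟨W, hW, hle⟩ := ih k
    have hk' : tpow C (p+1) i j = C i k * tpow C p k j := hk
    have hC' : C i k = A i k / μ ∨ C i k = B i k / ν := by
      rw [hC]; exact max_choice _ _
    rcases hC' with e | e
    · refine ⟨false :: W, by simp [hW], le_trans ?_ (le_tmul A (wP A B W) i k j)⟩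
      refine le_trans (le_of_eq ?_) (mul_le_mul_of_nonneg_left hle (hA i k))
      rw [hk', e]; simp; field_simp; ring
    · refine ⟨true :: W, by simp [hW], le_trans ?_ (le_tmul B (wP A B W) i k j)⟩
      refine le_trans (le_of_eq ?_) (mul_le_mul_of_nonneg_left hle (hB i k))
      rw [hk', e]; simp; field_simp; ring

theorem walk_le {n : ℕ} [Nonempty (Fin n)] {C : Matrix (Fin n) (Fin n) ℝ}
    (hC : ∀ i j, 0 ≤ C i j) (v : ℕ → Fin n) (a d : ℕ) :
    ∏ t ∈ Finset.Ico a (a + d), C (v t) (v (t+1)) ≤ tpow C d (v a) (v (a + d)) := by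
  induction d generalizing a with
  | zero => simp [tpow]
  | succ d ih =>
    rw [Finset.prod_eq_prod_Ico_succ_bot (by omega)]
    have := ih (a+1)
    rw [show a + 1 + d = a + (d + 1) by omega] at this
    exact (mul_le_mul_of_nonneg_left this (hC _ _)).trans (le_tmul C (tpow C d) _ (v (a+1)) _)

theorem walk_ex {n : ℕ} [Nonempty (Fin n)] {C : Matrix (Fin n) (Fin n) ℝ}
    (hC : ∀ i j, 0 ≤ C i j) (p : ℕ) (i j : Fin n) (h : tpow C p i j ≠ 0) :
    ∃ v : ℕ → Fin n, v 0 = i ∧ v p = j ∧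
      tpow C p i j = ∏ t ∈ Finset.range p, C (v t) (v (t+1)) := by
  induction p generalizing i with
  | zero =>
    have : i = j := by
      by_contra hne
      exact h (by simp [tpow, hne])
    exact ⟨fun _ => i, rfl, this, by simp [tpow, this]⟩
  | succ p ih =>
    obtain ⟨k, hk⟩ := ex_tmul C (tpow C p) i j
    have hk' : tpow C (p+1) i j = C i k * tpow C p k j := hk
    obtain ⟨v, h0, h1, h2⟩ := ih k (fun e => h (by rw [hk', e, mul_zero]))
    refine ⟨fun t => Nat.casesOn t i v, rfl, h1, ?_⟩
    rw [hk', h2, Finset.prod_range_succ']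
    simp only [h0]
    exact mul_comm _ _

theorem le_tkstar {n : ℕ} (C : Matrix (Fin n) (Fin n) ℝ) (k : ℕ) (hk : k < n) (i j : Fin n) :
    tpow C k i j ≤ kstar C i j :=
  le_ciSup (f := fun k : Fin n => tpow C k.1 i j) (Set.finite_range _).bddAbove ⟨k, hk⟩

theorem tpow_n_le_kstar {n : ℕ} [Nonempty (Fin n)] {C : Matrix (Fin n) (Fin n) ℝ}
    (hC : ∀ i j, 0 ≤ C i j) (hcyc : ∀ p, 1 ≤ p → p ≤ n → ∀ i, tpow C p i i ≤ 1) (i j : Fin n) :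
    tpow C n i j ≤ kstar C i j := by
  by_cases h : tpow C n i j = 0
  · rw [h]; exact Real.iSup_nonneg fun k => tpow_nonneg hC _ i j
  obtain ⟨v, h0, h1, h2⟩ := walk_ex hC n i j h
  obtain ⟨a, b, hab, hbn, hv⟩ : ∃ a b, a < b ∧ b ≤ n ∧ v a = v b := by
    obtain ⟨a, b, hne, hv⟩ := Fintype.exists_ne_map_eq_of_card_lt
      (fun t : Fin (n+1) => v t.1) (by simp)
    rcases lt_or_gt_of_ne hne with hlt | hlt
    · exact ⟨a.1, b.1, hlt, by omega, hv⟩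
    · exact ⟨b.1, a.1, hlt, by omega, hv.symm⟩
  have hw1 := walk_le hC v 0 a
  have hw2 := walk_le hC v a (b - a)
  have hw3 := walk_le hC v b (n - b)
  rw [Nat.zero_add, h0] at hw1
  rw [Nat.add_sub_cancel' hab.le, ← hv] at hw2
  rw [Nat.add_sub_cancel' hbn, h1, ← hv] at hw3
  have hc := hw2.trans (hcyc (b - a) (by omega) (by omega) (v a))
  have hpos : ∀ s : Finset ℕ, 0 ≤ ∏ t ∈ s, C (v t) (v (t+1)) :=
    fun s => Finset.prod_nonneg fun t _ => hC _ _
  rw [h2, Finset.range_eq_Ico, ← Finset.prod_Ico_consecutive _ (Nat.zero_le a) (hab.le.trans hbn),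
    ← Finset.prod_Ico_consecutive _ hab.le hbn]
  refine le_trans ?_ (le_tkstar C (a + (n - b)) (by omega) i j)
  refine le_trans ?_ (tpow_mul_le hC a (n - b) i (v a) j)
  refine mul_le_mul hw1 ?_ (mul_nonneg (hpos _) (hpos _)) (tpow_nonneg hC _ _ _)
  exact (mul_le_of_le_one_left (hpos _) hc).trans hw3

theorem mul_tkstar_le {n : ℕ} [Nonempty (Fin n)] {C : Matrix (Fin n) (Fin n) ℝ}
    (hC : ∀ i j, 0 ≤ C i j) (hcyc : ∀ p, 1 ≤ p → p ≤ n → ∀ i, tpow C p i i ≤ 1)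
    (i k j : Fin n) : C i k * kstar C k j ≤ kstar C i j := by
  obtain ⟨q, hq⟩ := exists_eq_ciSup_of_finite (f := fun q : Fin n => tpow C q.1 k j)
  have hq' : kstar C k j = tpow C q.1 k j := hq.symm
  rw [hq']
  refine (le_tmul C (tpow C q.1) i k j).trans ?_
  change tpow C (q.1 + 1) i j ≤ _
  rcases Nat.lt_or_ge (q.1 + 1) n with hlt | hge
  · exact le_tkstar C _ hlt i j
  · rw [show q.1 + 1 = n by omega]
    exact tpow_n_le_kstar hC hcyc i j

/-- if `μ ≥ G(ν)`, the Pareto frontier is the single point `(μ, ν)`, and the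
positive vectors attaining it are exactly `x = (μ⁻¹ A ⊕ ν⁻¹ B)* ⊗ u`, `u > 0`. -/
theorem stmt5 {n : ℕ} (A B : Matrix (Fin n) (Fin n) ℝ)
    (hA : ∀ i j, 0 ≤ A i j) (hB : ∀ i j, 0 ≤ B i j)
    (hμ : 0 < specRad A) (hν : 0 < specRad B)
    (h : Gfun A B (specRad B) ≤ specRad A) :
    ParetoFrontier A B = {(specRad A, specRad B)} ∧
      { x : Fin n → ℝ | (∀ i, 0 < x i) ∧ obj A x = specRad A ∧ obj B x = specRad B } =
        { x : Fin n → ℝ | ∃ u : Fin n → ℝ, (∀ i, 0 < u i) ∧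
          x = fun i => ⨆ j,
            kstar (Matrix.of fun i' j' =>
              max (A i' j' / specRad A) (B i' j' / specRad B)) i j * u j } := by
  have hn : Nonempty (Fin n) := by
    by_contra hne
    rw [not_nonempty_iff] at hne
    simp [specRad] at hμ
  have hnpos : 0 < n := Fin.pos_iff_nonempty.2 hn
  set μ := specRad A with hμd
  set ν := specRad B with hνd
  obtain ⟨C, hCd⟩ : ∃ C : Matrix (Fin n) (Fin n) ℝ,
    C = Matrix.of fun i' j' => max (A i' j' / μ) (B i' j' / ν) := ⟨_, rfl⟩
  rw [← hCd]
  have hCA : ∀ i j, A i j / μ ≤ C i j := fun i j => by rw [hCd]; exact le_max_left _ _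
  have hCB : ∀ i j, B i j / ν ≤ C i j := fun i j => by rw [hCd]; exact le_max_right _ _
  have hC : ∀ i j, 0 ≤ C i j := fun i j => (div_nonneg (hA i j) hμ.le).trans (hCA i j)
  have hcyc : ∀ p, 1 ≤ p → p ≤ n → ∀ i, tpow C p i i ≤ 1 := by
    intro p h1 h2 i
    obtain ⟨W, hW, hle⟩ := tpow_le_wP hμ hν hA hB hCd p i i
    have h3 := hle.trans (wP_diag_le hA hB hν h W (by omega) (by omega) i)
    exact (mul_le_iff_le_one_left (by positivity)).1 h3
  -- the main equivalence
  have hkey : ∀ x : Fin n → ℝ, (∀ i, 0 < x i) →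
      ((obj A x = μ ∧ obj B x = ν) ↔ ∀ i j, C i j * x j ≤ x i) := by
    intro x hx
    have e : (obj A x = μ ∧ obj B x = ν) ↔ (obj A x ≤ μ ∧ obj B x ≤ ν) :=
      ⟨fun h => ⟨h.1.le, h.2.le⟩, fun h => ⟨le_antisymm h.1 (specRad_le_obj hA hx),
        le_antisymm h.2 (specRad_le_obj hB hx)⟩⟩
    rw [e, obj_le_iff A hx, obj_le_iff B hx]
    constructor
    · rintro ⟨ha, hb⟩ i j
      rw [hCd, Matrix.of_apply, max_mul_of_nonneg _ _ (hx j).le]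
      refine max_le ?_ ?_
      · rw [div_mul_eq_mul_div, div_le_iff₀ hμ, mul_comm (x i)]; exact ha i j
      · rw [div_mul_eq_mul_div, div_le_iff₀ hν, mul_comm (x i)]; exact hb i j
    · intro hc
      refine ⟨fun i j => ?_, fun i j => ?_⟩
      · have := (mul_le_mul_of_nonneg_right (hCA i j) (hx j).le).trans (hc i j)
        rwa [div_mul_eq_mul_div, div_le_iff₀ hμ, mul_comm (x i)] at this
      · have := (mul_le_mul_of_nonneg_right (hCB i j) (hx j).le).trans (hc i j)
        rwa [div_mul_eq_mul_div, div_le_iff₀ hν, mul_comm (x i)] at this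
  have hdiag : ∀ i, 1 ≤ kstar C i i := fun i => by
    have := le_tkstar C 0 hnpos i i
    simpa [tpow] using this
  have hle : ∀ (u : Fin n → ℝ) (i j : Fin n), kstar C i j * u j ≤ ⨆ j, kstar C i j * u j :=
    fun u i j => le_ciSup (f := fun j => kstar C i j * u j) (Set.finite_range _).bddAbove j
  have hgen : ∀ u : Fin n → ℝ, (∀ i, 0 < u i) →
      (∀ i, 0 < ⨆ j, kstar C i j * u j) ∧
      ∀ i k, C i k * (⨆ j, kstar C k j * u j) ≤ ⨆ j, kstar C i j * u j := by
    intro u hu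
    refine ⟨fun i => ?_, fun i k => ?_⟩
    · exact (mul_pos (lt_of_lt_of_le one_pos (hdiag i)) (hu i)).trans_le (hle u i i)
    · obtain ⟨j, hj⟩ := exists_eq_ciSup_of_finite (f := fun j => kstar C k j * u j)
      rw [← hj, ← mul_assoc]
      exact (mul_le_mul_of_nonneg_right (mul_tkstar_le hC hcyc i k j) (hu j).le).trans (hle u i j)
  obtain ⟨y, hy, hyA, hyB⟩ : ∃ y : Fin n → ℝ, (∀ i, 0 < y i) ∧ obj A y = μ ∧ obj B y = ν := by
    obtain ⟨h1, h2⟩ := hgen (fun _ => 1) (fun _ => one_pos)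
    exact ⟨_, h1, (hkey _ h1).2 h2⟩
  constructor
  · ext p
    simp only [ParetoFrontier, Set.mem_ofPred_eq, Set.mem_singleton_iff]
    constructor
    · rintro ⟨x, ⟨hx, hopt⟩, rfl⟩
      by_contra hne
      refine hopt ⟨y, hy, ?_, ?_, ?_⟩
      · rw [hyA]; exact specRad_le_obj hA hx
      · rw [hyB]; exact specRad_le_obj hB hx
      · rw [hyA, hyB]; exact fun e => hne e.symm
    · rintro rfl
      refine ⟨y, ⟨hy, ?_⟩, by rw [hyA, hyB]⟩
      rintro ⟨z, hz, h1, h2, h3⟩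
      rw [hyA] at h1
      rw [hyB] at h2
      apply h3
      rw [hyA, hyB, le_antisymm h1 (specRad_le_obj hA hz), le_antisymm h2 (specRad_le_obj hB hz)]
  · ext x
    simp only [Set.mem_ofPred_eq]
    constructor
    · rintro ⟨hx, h12⟩
      have hc := (hkey x hx).1 h12
      refine ⟨x, hx, ?_⟩
      funext i
      apply le_antisymm
      · exact (le_mul_of_one_le_left (hx i).le (hdiag i)).trans (hle x i i)
      · refine ciSup_le fun j => ?_
        obtain ⟨q, hq⟩ := exists_eq_ciSup_of_finite (f := fun q : Fin n => tpow C q.1 i j)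
        have hq' : kstar C i j = tpow C q.1 i j := hq.symm
        rw [hq']
        have := tpow_le_of hC zero_le_one (by simpa using hc) hx q.1 i j
        simpa using this
    · rintro ⟨u, hu, rfl⟩
      obtain ⟨h1, h2⟩ := hgen u hu
      exact ⟨h1, (hkey _ h1).2 h2⟩
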